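/- arXiv:2311.16327 — 5 statements merged into one kernel-verified Lean document; each statement's English description precedes it below -/
import Mathlib

section
/- Let k be a field and g a k-vector space equipped with a bilinear operation [·,·] : g × g → g satisfying the (left) Leibniz identity [x,[y,z]] = [[x,y],z] + [y,[x,z]] for all x, y, z ∈ g. For n ≥ 1 define d : g^{⊗n} → g^{⊗(n−1)} by d = Σ_{1 ≤ i < j ≤ n} (−1)^{n−i} d^{(ij)}, where d^{(ij)}(a₁ ⊗ ⋯ ⊗ aₙ) = a₁ ⊗ ⋯ ⊗ âᵢ ⊗ ⋯ ⊗ a_{j−1} ⊗ [aᵢ,aⱼ] ⊗ a_{j+1} ⊗ ⋯ ⊗ aₙ (the i-th factor is omitted and the j-th factor is replaced by [aᵢ,aⱼ]). Then d ∘ d = 0, i.e. the spaces Cₙ = g^{⊗n} with these differentials form a chain complex. -/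
open scoped TensorProduct

section LodayAux

open Function

variable {k : Type*} [Field k] {g : Type*} [AddCommGroup g] [Module k g]

/-- Tensor obtained by bracketing `x` into `j`, then `y` into `Q`, and restricting along `E`. -/
noncomputable def lodayM (br : g →ₗ[k] g →ₗ[k] g) {m n : ℕ} (a : Fin m → g) (E : Fin n → Fin m)
    (x y j Q : Fin m) : ⨂[k] _ : Fin n, g :=
  PiTensorProduct.tprod k
    ((update (update a j (br (a x) (a j))) Q
      (br (update a j (br (a x) (a j)) y) (update a j (br (a x) (a j)) Q))) ∘ E)

/-- Sum of all the double bracketings which remove first `x` and then `y`. -/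
noncomputable def lodayH (br : g →ₗ[k] g →ₗ[k] g) {m n : ℕ} (a : Fin m → g) (E : Fin n → Fin m)
    (x y : Fin m) : ⨂[k] _ : Fin n, g :=
  ∑ j, ∑ Q, if x < j ∧ Q ≠ x ∧ y < Q then lodayM br a E x y j Q else 0

theorem lodayH_symm_lt (br : g →ₗ[k] g →ₗ[k] g)
    (leibniz : ∀ x y z : g, br x (br y z) = br (br x y) z + br y (br x z))
    {m n : ℕ} (a : Fin m → g) (E : Fin n → Fin m) (hE : Injective E) (x y : Fin m)
    (hx : ∀ t, E t ≠ x) (hy : ∀ t, E t ≠ y) (hs : ∀ Q, Q ≠ x → Q ≠ y → ∃ t, E t = Q)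
    (hxy : x < y) : lodayH br a E x y = lodayH br a E y x := by
  unfold lodayH
  rw [Finset.sum_comm, ← sub_eq_zero, ← Finset.sum_sub_distrib]
  refine Finset.sum_eq_zero fun Q _ => ?_
  rw [← Finset.sum_sub_distrib]
  by_cases hQ : y < Q
  swap
  · refine Finset.sum_eq_zero fun j _ => ?_
    simp [hQ]
  have hQx : Q ≠ x := (hxy.trans hQ).ne'
  have hQy : Q ≠ y := hQ.ne'
  rw [Finset.sum_eq_add y Q hQy.symm]
  · obtain ⟨t, rfl⟩ := hs Q hQx hQy
    have key : ∀ (f : Fin m → g) (v : g), update f (E t) v ∘ E = update (f ∘ E) t v :=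
      fun f v => update_comp_eq_of_injective f hE t v
    have h1 : lodayM br a E x y y (E t) = PiTensorProduct.tprod k
        (update (a ∘ E) t (br (br (a x) (a y)) (a (E t)))) := by
      unfold lodayM
      rw [key]
      congr 1
      ext s
      by_cases h : s = t
      · subst h; simp [hQy]
      · simp [h, hy s]
    have h2 : ∀ u v, v ≠ E t → lodayM br a E u v (E t) (E t) = PiTensorProduct.tprod k
        (update (a ∘ E) t (br (a v) (br (a u) (a (E t))))) := by
      intro u v hv
      unfold lodayM
      rw [key, key]
      simp [hv]
    rw [h1, h2 x y hQy.symm, h2 y x hQx.symm]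
    simp only [hxy, hQ, hQx, hQy, hxy.trans hQ, ne_eq, not_true, not_false_iff, and_true,
      true_and, if_true, false_and, and_false, if_false, sub_zero]
    rw [leibniz (a x) (a y), MultilinearMap.map_update_add]
    abel
  · intro j _ hj
    obtain ⟨hjy, hjQ⟩ := hj
    by_cases hj : x < j
    swap
    · simp [hj]
    have : lodayM br a E x y j Q = lodayM br a E y x Q j := by
      unfold lodayM
      rw [update_of_ne (Ne.symm hjy), update_of_ne (Ne.symm hjQ), update_of_ne hQx.symm,
        update_of_ne hjQ, update_comm hjQ]
    simp [hj, hQ, hjy, hQx, this]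
  · simp
  · simp

theorem lodayH_symm (br : g →ₗ[k] g →ₗ[k] g)
    (leibniz : ∀ x y z : g, br x (br y z) = br (br x y) z + br y (br x z))
    {m n : ℕ} (a : Fin m → g) (E : Fin n → Fin m) (hE : Injective E) (x y : Fin m)
    (hx : ∀ t, E t ≠ x) (hy : ∀ t, E t ≠ y) (hs : ∀ Q, Q ≠ x → Q ≠ y → ∃ t, E t = Q)
    (hxy : x ≠ y) : lodayH br a E x y = lodayH br a E y x := by
  rcases lt_or_gt_of_ne hxy with h | h
  · exact lodayH_symm_lt br leibniz a E hE x y hx hy hs h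
  · exact (lodayH_symm_lt br leibniz a E hE y x hy hx (fun Q h1 h2 => hs Q h2 h1) h).symm

theorem loday_sign (n : ℕ) (i : Fin (n + 2)) (p : Fin (n + 1)) :
    (-1 : k) ^ (n + 1 - (i.succAbove p : ℕ)) * (-1 : k) ^ (n - (p.predAbove i : ℕ)) =
      - ((-1 : k) ^ (n + 1 - (i : ℕ)) * (-1 : k) ^ (n - (p : ℕ))) := by
  have hi := i.isLt
  have hp := p.isLt
  rcases lt_or_ge p.castSucc i with h | h
  · rw [Fin.succAbove_of_castSucc_lt _ _ h, Fin.predAbove_of_castSucc_lt _ _ h]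
    have h' : (p : ℕ) < i := h
    simp only [Fin.val_castSucc, Fin.val_pred]
    rw [show n + 1 - (p : ℕ) = (n - p) + 1 by omega,
      show n - ((i : ℕ) - 1) = n + 1 - i by omega, pow_succ]
    ring
  · rw [Fin.succAbove_of_le_castSucc _ _ h, Fin.predAbove_of_le_castSucc _ _ h]
    have h' : (i : ℕ) ≤ p := h
    simp only [Fin.val_succ, Fin.coe_castPred]
    rw [show n + 1 - ((p : ℕ) + 1) = n - p by omega,
      show n + 1 - (i : ℕ) = (n - i) + 1 by omega, pow_succ]
    ring

theorem loday_inner (br : g →ₗ[k] g →ₗ[k] g) (n : ℕ) (a : Fin (n + 2) → g)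
    (i j : Fin (n + 2)) (p : Fin (n + 1)) :
    (∑ q : Fin (n + 1), if p < q then
      PiTensorProduct.tprod k
        (update (update a j (br (a i) (a j)) ∘ i.succAbove) q
          (br ((update a j (br (a i) (a j)) ∘ i.succAbove) p)
            ((update a j (br (a i) (a j)) ∘ i.succAbove) q)) ∘ p.succAbove) else 0) =
    ∑ Q : Fin (n + 2), if Q ≠ i ∧ i.succAbove p < Q then
      lodayM br a (i.succAbove ∘ p.succAbove) i (i.succAbove p) j Q else 0 := by
  rw [Fin.sum_univ_succAbove _ i]
  simp only [ne_eq, not_true, false_and, if_false, zero_add, Fin.succAbove_ne, not_false_iff,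
    true_and, Fin.succAbove_lt_succAbove_iff]
  refine Finset.sum_congr rfl fun q _ => ?_
  congr 1
  unfold lodayM
  rw [← update_comp_eq_of_injective _ Fin.succAbove_right_injective]
  rfl

end LodayAux

/-- **Loday's complex for a Leibniz algebra.**
Let `k` be a field and `g` a `k`-vector space with a bilinear bracket satisfying the
(left) Leibniz identity.  For each `n`, let `D n : g^{⊗(n+1)} → g^{⊗ n}` be the linear
map given on pure tensors by
`d = ∑_{i < j} (-1)^{(n+1)-i} d^{(ij)}`, where `d^{(ij)}` omits the `i`-th factor and
replaces the `j`-th factor by the bracket `[aᵢ, aⱼ]` (indices here are `0`-based, so the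
sign is `(-1)^(n - i)`).  Then `d ∘ d = 0`. -/
theorem loday_differential_squares_to_zero
    (k : Type*) [Field k] (g : Type*) [AddCommGroup g] [Module k g]
    (bracket : g →ₗ[k] g →ₗ[k] g)
    (leibniz : ∀ x y z : g,
      bracket x (bracket y z) = bracket (bracket x y) z + bracket y (bracket x z))
    (D : ∀ n : ℕ, (⨂[k] _ : Fin (n + 1), g) →ₗ[k] ⨂[k] _ : Fin n, g)
    (hD : ∀ (n : ℕ) (a : Fin (n + 1) → g),
      D n (PiTensorProduct.tprod k a) =
        ∑ i : Fin (n + 1), ∑ j : Fin (n + 1),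
          if i < j then
            ((-1 : k) ^ (n - (i : ℕ))) •
              PiTensorProduct.tprod k
                (fun t : Fin n =>
                  if i.succAbove t = j then bracket (a i) (a j) else a (i.succAbove t))
          else 0) :
    ∀ n : ℕ, (D n).comp (D (n + 1)) = 0 := by
  classical
  have hD' : ∀ (n : ℕ) (a : Fin (n + 1) → g),
      D n (PiTensorProduct.tprod k a) =
        ∑ i : Fin (n + 1), ((-1 : k) ^ (n - (i : ℕ))) • ∑ j : Fin (n + 1),
          if i < j then
              PiTensorProduct.tprod k
                (Function.update a j (bracket (a i) (a j)) ∘ i.succAbove)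
          else 0 := by
    intro n a
    rw [hD]
    refine Finset.sum_congr rfl fun i _ => ?_
    rw [Finset.smul_sum]
    refine Finset.sum_congr rfl fun j _ => ?_
    split_ifs with h
    · congr 2
      ext t
      simp [Function.update_apply]
    · simp
  intro n
  ext a
  simp only [LinearMap.compMultilinearMap_apply, LinearMap.comp_apply, LinearMap.zero_apply]
  have main : D n (D (n + 1) (PiTensorProduct.tprod k a)) =
      ∑ i : Fin (n + 2), ∑ p : Fin (n + 1),
        ((-1 : k) ^ (n + 1 - (i : ℕ)) * (-1 : k) ^ (n - (p : ℕ))) •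
          lodayH bracket a (i.succAbove ∘ p.succAbove) i (i.succAbove p) := by
    rw [hD', map_sum]
    refine Finset.sum_congr rfl fun i _ => ?_
    simp only [mul_smul]
    rw [map_smul, ← Finset.smul_sum, map_sum]
    congr 1
    unfold lodayH
    simp only [Finset.smul_sum]
    rw [Finset.sum_comm]
    refine Finset.sum_congr rfl fun j _ => ?_
    by_cases h : i < j
    · simp only [h, if_true, true_and]
      rw [hD']
      refine Finset.sum_congr rfl fun p _ => ?_
      rw [loday_inner, Finset.smul_sum]
    · simp [h]
  rw [main, ← Finset.sum_product']
  refine Finset.sum_involution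
    (fun (ip : Fin (n + 2) × Fin (n + 1)) _ => (ip.1.succAbove ip.2, ip.2.predAbove ip.1))
    ?_ ?_ ?_ ?_
  · rintro ⟨i, p⟩ _
    have hc : (i.succAbove p).succAbove ∘ (p.predAbove i).succAbove =
        i.succAbove ∘ p.succAbove := by
      ext t
      simp [Fin.succAbove_succAbove_succAbove_predAbove]
    have hi : (i.succAbove p).succAbove (p.predAbove i) = i :=
      Fin.succAbove_succAbove_predAbove i p
    dsimp only
    rw [hc, hi, loday_sign, lodayH_symm bracket leibniz a _ _ i (i.succAbove p), neg_smul,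
      add_neg_cancel]
    · intro t
      exact Fin.succAbove_ne _ _
    · intro t h
      exact Fin.succAbove_ne _ _ (Fin.succAbove_right_injective h)
    · intro Q h1 h2
      obtain ⟨q, rfl⟩ := Fin.exists_succAbove_eq h1
      obtain ⟨t, rfl⟩ := Fin.exists_succAbove_eq (fun h : q = p => h2 (by rw [h]))
      exact ⟨t, rfl⟩
    · exact (Fin.succAbove_ne _ _).symm
    · exact Fin.succAbove_right_injective.comp Fin.succAbove_right_injective
  · rintro ⟨i, p⟩ _ _ h
    exact Fin.succAbove_ne i p (congrArg Prod.fst h)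
  · simp
  · rintro ⟨i, p⟩ _
    simp only [Prod.mk.injEq]
    exact ⟨Fin.succAbove_succAbove_predAbove i p, Fin.predAbove_predAbove_succAbove i p⟩
end

section
/- For every z ∈ ℂ with z ∉ Λ one has ζ(z+1) = ζ(z) + G₂(τ) and ζ(z+τ) = ζ(z) + τ·G₂(τ) − 2πi. Equivalently, the modified zeta function ẑ(z) := ζ(z) − G₂(τ)·z satisfies ẑ(z+1) = ẑ(z) and ẑ(z+τ) = ẑ(z) − 2πi for all z ∉ Λ. -/
noncomputable section

/-- The lattice point `m + n·τ` associated to `p = (m, n) : ℤ × ℤ`. -/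
def lat (τ : ℂ) (p : ℤ × ℤ) : ℂ := (p.1 : ℂ) + (p.2 : ℂ) * τ

/-- Membership in the lattice `Λ = ℤ + ℤτ`. -/
def inLat (τ z : ℂ) : Prop := ∃ p : ℤ × ℤ, z = lat τ p

/-- The Weierstrass zeta function
`ζ(z) = 1/z + Σ_{λ ∈ Λ∖{0}} (1/(z−λ) + 1/λ + z/λ²)`. -/
def wzeta (τ z : ℂ) : ℂ :=
  1 / z + ∑' p : {p : ℤ × ℤ // p ≠ 0},
    (1 / (z - lat τ ↑p) + 1 / lat τ ↑p + z / (lat τ ↑p) ^ 2)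

/-- The quasimodular Eisenstein series of weight 2,
`G₂(τ) = (π²/3)·(1 − 24 Σ_{n≥1} n qⁿ/(1−qⁿ))` with `q = exp(2πiτ)`. -/
def G2 (τ : ℂ) : ℂ :=
  ((Real.pi : ℂ) ^ 2 / 3) *
    (1 - 24 * ∑' n : ℕ, (n : ℂ) * Complex.exp (2 * (Real.pi : ℂ) * Complex.I * τ) ^ n /
      (1 - Complex.exp (2 * (Real.pi : ℂ) * Complex.I * τ) ^ n))

open Filter Topology Complex SummationFilter

/-- General term of the zeta series. -/
def zt (τ z : ℂ) (p : ℤ × ℤ) : ℂ := 1 / (z - lat τ p) + 1 / lat τ p + z / (lat τ p) ^ 2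

lemma lat_bound (τ : ℂ) (hτ : 0 < τ.im) :
    ∃ r : ℝ, 0 < r ∧ ∀ x : Fin 2 → ℤ, r * ‖x‖ ≤ ‖lat τ (x 1, x 0)‖ := by
  refine ⟨EisensteinSeries.r ⟨τ, hτ⟩, EisensteinSeries.r_pos _, fun x => ?_⟩
  by_cases hx : x = 0
  · simp [hx]
  · have := EisensteinSeries.r_mul_max_le ⟨τ, hτ⟩ hx
    simpa [lat, add_comm] using this

lemma zt_eq (τ z : ℂ) (p : ℤ × ℤ) (h1 : z - lat τ p ≠ 0) (h2 : lat τ p ≠ 0) :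
    zt τ z p = z ^ 2 / (lat τ p ^ 2 * (z - lat τ p)) := by
  unfold zt
  field_simp
  ring

lemma zt_summable (τ : ℂ) (hτ : 0 < τ.im) (z : ℂ) : Summable (zt τ z) := by
  obtain ⟨r, hr, hb⟩ := lat_bound τ hτ
  have key : Summable fun x : Fin 2 → ℤ => zt τ z (x 1, x 0) := by
    apply EisensteinSeries.summable_of_isBigO_rpow_norm (a := 3) (by norm_num)
    rw [Asymptotics.isBigO_iff]
    refine ⟨2 * ‖z‖ ^ 2 / r ^ 3, ?_⟩
    have hc : Tendsto (fun x : Fin 2 → ℤ => ‖x‖) cofinite atTop := by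
      simpa [Function.comp_def] using
        tendsto_norm_comp_cofinite_atTop_of_isClosedEmbedding (e := fun x : Fin 2 → ℤ => x)
          IsClosedEmbedding.id
    filter_upwards [hc.eventually_gt_atTop (2 * ‖z‖ / r), hc.eventually_gt_atTop 0] with x h1 h2
    rw [div_lt_iff₀ hr] at h1
    have h3 := hb x
    set l := lat τ (x 1, x 0) with hl
    have h4 : 0 < r * ‖x‖ := by positivity
    have h5 : r * ‖x‖ / 2 ≤ ‖z - l‖ := by
      have := norm_sub_norm_le l z
      rw [norm_sub_rev] at this
      linarith
    have hl0 : l ≠ 0 := norm_pos_iff.1 (by linarith)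
    have hzl0 : z - l ≠ 0 := norm_pos_iff.1 (by linarith)
    rw [zt_eq τ z _ hzl0 hl0, ← hl]
    rw [norm_div, norm_mul, norm_pow, norm_pow]
    have h6 : (r * ‖x‖) ^ 2 * (r * ‖x‖ / 2) ≤ ‖l‖ ^ 2 * ‖z - l‖ := by gcongr
    calc ‖z‖ ^ 2 / (‖l‖ ^ 2 * ‖z - l‖) ≤ ‖z‖ ^ 2 / ((r * ‖x‖) ^ 2 * (r * ‖x‖ / 2)) := by gcongr
      _ = _ := by
        have : (‖x‖ ^ (3:ℝ)) = ‖x‖ ^ 3 := by norm_cast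
        rw [this, Real.norm_of_nonneg (by positivity)]
        field_simp
  rw [← ((finTwoArrowEquiv ℤ).trans (Equiv.prodComm ℤ ℤ)).summable_iff]
  exact key.congr fun x => by simp [Function.comp_def]

lemma wzeta_eq (τ : ℂ) (hτ : 0 < τ.im) (z : ℂ) : wzeta τ z = ∑' p, zt τ z p := by
  have := (zt_summable τ hτ z).tsum_subtype_add_tsum_subtype_compl {p | p ≠ 0}
  rw [← this, wzeta, add_comm]
  congr 1
  have h : ({p : ℤ × ℤ | p ≠ 0}ᶜ : Set (ℤ × ℤ)) = {0} := by ext; simp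
  rw [h, tsum_singleton]
  simp [zt, lat]

/-- The difference term. -/
def dt (τ z a : ℂ) (p : ℤ × ℤ) : ℂ := 1 / (z + a - lat τ p) - 1 / (z - lat τ p) + a / lat τ p ^ 2

lemma dt_summable (τ : ℂ) (hτ : 0 < τ.im) (z a : ℂ) : Summable (dt τ z a) :=
  ((zt_summable τ hτ (z + a)).sub (zt_summable τ hτ z)).congr fun p => by
    simp only [zt, dt]; ring

lemma wzeta_sub (τ : ℂ) (hτ : 0 < τ.im) (z a : ℂ) :
    wzeta τ (z + a) - wzeta τ z = ∑' n : ℤ, ∑' m : ℤ, dt τ z a (m, n) := by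
  rw [wzeta_eq τ hτ, wzeta_eq τ hτ, ← (zt_summable τ hτ (z + a)).tsum_sub (zt_summable τ hτ z)]
  have h : ∀ p, zt τ (z + a) p - zt τ z p = dt τ z a p := fun p => by
    simp only [zt, dt]; ring
  simp_rw [h]
  have h2 := (Equiv.prodComm ℤ ℤ).summable_iff.2 (dt_summable τ hτ z a)
  rw [← (Equiv.prodComm ℤ ℤ).tsum_eq]
  exact h2.tsum_prod

lemma rows_summable (τ : ℂ) (hτ : 0 < τ.im) (z a : ℂ) :
    Summable fun n : ℤ => ∑' m : ℤ, dt τ z a (m, n) :=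
  ((Equiv.prodComm ℤ ℤ).summable_iff.2 (dt_summable τ hτ z a)).prod

lemma row_summable (τ : ℂ) (hτ : 0 < τ.im) (z a : ℂ) (n : ℤ) :
    Summable fun m : ℤ => dt τ z a (m, n) :=
  ((Equiv.prodComm ℤ ℤ).summable_iff.2 (dt_summable τ hτ z a)).prod_factor n

/-- `π cot (π w)`. -/
def C (w : ℂ) : ℂ := (Real.pi : ℂ) * Complex.cot (Real.pi * w)

lemma cot_summable {x : ℂ} (hx : x ∈ integerComplement) :
    Summable fun n : ℕ+ => 1 / (x - (n : ℂ)) + 1 / (x + (n : ℂ)) := by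
  rw [summable_pnat_iff_summable_succ (f := fun n : ℕ => 1 / (x - (n : ℂ)) + 1 / (x + (n : ℂ)))]
  exact (summable_cotTerm hx).congr fun n => by simp [cotTerm]

lemma tsum_cot_sub {x y : ℂ} (hx : x ∈ integerComplement) (hy : y ∈ integerComplement)
    (hs : Summable fun m : ℤ => 1 / (x - m) - 1 / (y - m)) :
    ∑' m : ℤ, (1 / (x - m) - 1 / (y - m)) = C x - C y := by
  rw [C, C, cot_series_rep hx, cot_series_rep hy]
  have h1 := summable_int_iff_summable_nat_and_neg.1 hs
  rw [tsum_int_eq_zero_add_tsum_pnat hs]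
  rw [add_assoc, ← (summable_pnat_iff_summable_nat.2 h1.1).tsum_add
    (summable_pnat_iff_summable_nat.2 h1.2)]
  rw [add_sub_add_comm, ← (cot_summable hx).tsum_sub (cot_summable hy)]
  congr 1
  · simp
  · refine tsum_congr fun n => ?_
    push_cast
    simp only [sub_neg_eq_add]
    ring

lemma e2_eq (τ : ℂ) (hτ : 0 < τ.im) (n : ℤ) :
    HasSum (fun m : ℤ => 1 / lat τ (m, n) ^ 2) (EisensteinSeries.e2Summand n ⟨τ, hτ⟩) := by
  have := (EisensteinSeries.e2Summand_summable n ⟨τ, hτ⟩).hasSum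
  convert this using 1
  ext m
  simp only [lat, EisensteinSeries.eisSummand]
  simp [zpow_neg, add_comm]
  norm_cast

lemma row_eq (τ : ℂ) (hτ : 0 < τ.im) (z a : ℂ) (n : ℤ) (h1 : z + a - n * τ ∈ integerComplement)
    (h2 : z - n * τ ∈ integerComplement) :
    ∑' m : ℤ, dt τ z a (m, n) = C (z + a - n * τ) - C (z - n * τ) +
      a * EisensteinSeries.e2Summand n ⟨τ, hτ⟩ := by
  have he := (e2_eq τ hτ n).mul_left a
  have hs := row_summable τ hτ z a n
  have h3 : Summable fun m : ℤ => 1 / (z + a - n * τ - m) - 1 / (z - n * τ - m) := by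
    refine (hs.sub he.summable).congr fun m => ?_
    simp only [dt, lat]
    ring
  rw [← tsum_cot_sub h1 h2 h3, ← he.tsum_eq, ← h3.tsum_add he.summable]
  refine tsum_congr fun m => ?_
  simp only [dt, lat]
  ring

lemma G2_eq (τ : ℂ) (hτ : 0 < τ.im) : EisensteinSeries.G2 ⟨τ, hτ⟩ = G2 τ := by
  rw [EisensteinSeries.G2_eq_tsum_cexp, riemannZeta_two,
    ← tsum_pow_div_one_sub_eq_tsum_sigma (UpperHalfPlane.norm_exp_two_pi_I_lt_one ⟨τ, hτ⟩), G2]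
  have h := tsum_pnat_eq_tsum_of_eq_zero (f := fun n : ℕ => (n : ℂ) * exp (2 * Real.pi * I * τ) ^ n /
      (1 - exp (2 * Real.pi * I * τ) ^ n)) (by simp)
  rw [← h]
  simp only [pow_one]
  ring

lemma C_add_one (w : ℂ) : C (w + 1) = C w := by
  rw [C, C, cot_pi_eq_exp_ratio, cot_pi_eq_exp_ratio, mul_add, mul_one, exp_add, exp_two_pi_mul_I,
    mul_one]

lemma C_neg (w : ℂ) : C (-w) = - C w := by
  simp [C, Complex.cot, div_neg]

lemma C_tendsto (τ : ℂ) (hτ : 0 < τ.im) (w : ℂ) :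
    Tendsto (fun N : ℕ => C (w + N * τ)) atTop (𝓝 (-(Real.pi * I))) := by
  have h : Tendsto (fun N : ℕ => exp (2 * Real.pi * I * (w + N * τ))) atTop (𝓝 0) := by
    have h1 : ‖exp (2 * Real.pi * I * τ)‖ < 1 := UpperHalfPlane.norm_exp_two_pi_I_lt_one ⟨τ, hτ⟩
    have := (tendsto_pow_atTop_nhds_zero_of_norm_lt_one h1).const_mul (exp (2 * Real.pi * I * w))
    rw [mul_zero] at this
    refine this.congr fun N => ?_
    rw [← exp_nat_mul, ← exp_add]
    ring_nf
  unfold C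
  simp_rw [cot_pi_eq_exp_ratio]
  have h2 := ((h.add_const 1).div ((h.const_sub 1).const_mul I) (by simp)).const_mul (Real.pi : ℂ)
  have h3 : (Real.pi : ℂ) * ((0 + 1) / (I * (1 - 0))) = -(Real.pi * I) := by simp
  rw [h3] at h2
  exact h2

lemma not_int (τ z : ℂ) (hz : ¬ inLat τ z) (k : ℤ) (j n : ℤ) :
    z + k + j * τ - n * τ ∈ integerComplement := by
  rintro ⟨m, hm⟩
  apply hz
  refine ⟨(m - k, n - j), ?_⟩
  simp only [lat]
  push_cast
  rw [hm]
  ring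

/-- **Quasi-periodicity of the Weierstrass zeta function.**
For `z ∉ Λ` one has `ζ(z+1) = ζ(z) + G₂(τ)` and `ζ(z+τ) = ζ(z) + τ·G₂(τ) − 2πi`;
equivalently `ẑ(z) = ζ(z) − G₂(τ)·z` satisfies `ẑ(z+1) = ẑ(z)` and
`ẑ(z+τ) = ẑ(z) − 2πi`. -/
theorem wzeta_quasi_periodicity (τ : ℂ) (hτ : 0 < τ.im) (z : ℂ) (hz : ¬ inLat τ z) :
    wzeta τ (z + 1) = wzeta τ z + G2 τ ∧
    wzeta τ (z + τ) = wzeta τ z + τ * G2 τ - 2 * (Real.pi : ℂ) * Complex.I := by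
  have hn0 : ∀ n : ℤ, z - n * τ ∈ integerComplement := fun n => by
    simpa using not_int τ z hz 0 0 n
  have hn1 : ∀ n : ℤ, z + 1 - n * τ ∈ integerComplement := fun n => by
    simpa using not_int τ z hz 1 0 n
  have hnt : ∀ n : ℤ, z + τ - n * τ ∈ integerComplement := fun n => by
    simpa using not_int τ z hz 0 1 n
  have hG : HasSum (EisensteinSeries.e2Summand · ⟨τ, hτ⟩) (G2 τ) (symmetricIco ℤ) := by
    rw [← G2_eq τ hτ, EisensteinSeries.G2_eq_tsum_symmetricIco]
    exact (EisensteinSeries.summable_e2Summand_symmetricIco _).hasSum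
  constructor
  · rw [← sub_eq_iff_eq_add', wzeta_sub τ hτ]
    have h1 := (rows_summable τ hτ z 1).hasSum
    have h2 : HasSum _ _ (symmetricIco ℤ) := Tendsto.mono_left h1 (symmetricIco ℤ).le_atTop
    refine h2.unique (hG.congr_fun fun n => ?_)
    rw [row_eq τ hτ z 1 n (hn1 n) (hn0 n), show z + 1 - n * τ = z - n * τ + 1 by ring, C_add_one]
    ring
  · rw [add_sub_assoc, ← sub_eq_iff_eq_add', wzeta_sub τ hτ]
    have h1 := (rows_summable τ hτ z τ).hasSum
    have h2 : HasSum _ _ (symmetricIco ℤ) := Tendsto.mono_left h1 (symmetricIco ℤ).le_atTop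
    refine h2.unique ?_
    have h3 : HasSum (fun n : ℤ => C (z + τ - n * τ) - C (z - n * τ)) (-(2 * Real.pi * I))
        (symmetricIco ℤ) := by
      rw [hasSum_symmetricIco_int_iff]
      have ha := C_tendsto τ hτ (z + τ)
      have hb := (C_tendsto τ hτ (-z - τ)).neg
      have hc := ha.sub hb
      have hd : -(Real.pi * I) - - -(Real.pi * I) = -(2 * Real.pi * I) := by ring
      rw [hd] at hc
      refine hc.congr fun N => ?_
      rw [← C_neg]
      have := Finset.sum_Ico_int_sub N (fun n : ℤ => C (z + τ - n * τ))
      convert this.symm using 2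
      · push_cast; ring_nf
      · push_cast; ring_nf
      · push_cast; ring_nf
    have h4 := (hG.mul_left τ).add h3
    rw [← sub_eq_add_neg] at h4
    refine h4.congr_fun fun n => ?_
    rw [row_eq τ hτ z τ n (hnt n) (hn0 n)]
    ring

end
end

section
/- For all z, w ∈ ℂ with z ∉ Λ, w ∉ Λ and z−w ∉ Λ, one has (ζ(z−w) − ζ(z) + ζ(w))² = ℘(z) + ℘(w) + ℘(z−w). -/
noncomputable section

/-- The Weierstrass ℘-function `℘(z) = 1/z² + Σ_{λ ∈ Λ∖{0}} (1/(z−λ)² − 1/λ²)`. -/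
def wp (τ z : ℂ) : ℂ :=
  1 / z ^ 2 + ∑' p : {p : ℤ × ℤ // p ≠ 0},
    (1 / (z - lat τ ↑p) ^ 2 - 1 / (lat τ ↑p) ^ 2)

open Filter Topology

namespace WZ

variable (L : PeriodPair)

/-- The regular part of the Weierstrass zeta function at the origin. -/
def zE (z : ℂ) : ℂ :=
  ∑' l : L.lattice, if l.1 = 0 then 0 else (1 / (z - l) + 1 / l + z / l ^ 2)

/-- The Weierstrass zeta function of a period pair. -/
def Z (z : ℂ) : ℂ := 1 / z + zE L z

lemma zE_bound (r : ℝ) (hr : 0 < r) (s : ℂ) (hs : ‖s‖ < r) (l : ℂ) (h : 2 * r ≤ ‖l‖) :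
    ‖1 / (s - l) + 1 / l + s / l ^ 2‖ ≤ 2 * r ^ 2 * ‖l‖ ^ (-3 : ℝ) := by
  have h1 : s - l ≠ 0 := by
    intro h0
    rw [sub_eq_zero] at h0
    subst h0
    linarith
  have h2 : 0 < ‖l‖ := by linarith
  have h3 : l ≠ 0 := by simpa using h2
  have h4 : ‖l‖ / 2 ≤ ‖s - l‖ := by
    rw [norm_sub_rev]
    exact .trans (by linarith) (norm_sub_norm_le l s)
  calc
    _ = ‖s ^ 2 / ((s - l) * l ^ 2)‖ := by
      congr 1
      field_simp
      ring
    _ = ‖s‖ ^ 2 / (‖s - l‖ * ‖l‖ ^ 2) := by simp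
    _ ≤ r ^ 2 / ((‖l‖ / 2) * ‖l‖ ^ 2) := by gcongr
    _ = 2 * r ^ 2 / ‖l‖ ^ 3 := by field
    _ = _ := by norm_cast

lemma hasSumLU :
    HasSumLocallyUniformly
      (fun (l : L.lattice) (z : ℂ) ↦ if l.1 = 0 then 0 else (1 / (z - l) + 1 / l + z / l ^ 2))
      (zE L) := by
  refine L.hasSumLocallyUniformly_aux (u := (2 * · ^ 2 * ‖·‖ ^ (-3 : ℝ))) _
    (fun _ _ ↦ (ZLattice.summable_norm_rpow _ _ (by simp; norm_num)).mul_left _) fun r hr ↦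
    Filter.eventually_atTop.mpr ⟨2 * r, ?_⟩
  rintro _ h s hs l rfl
  split_ifs
  · rw [norm_zero]; positivity
  · exact zE_bound r hr s hs l h

lemma termDeriv (l z : ℂ) (h : z - l ≠ 0) :
    HasDerivAt (fun z : ℂ ↦ 1 / (z - l) + 1 / l + z / l ^ 2)
      (-(1 / (z - l) ^ 2 - 1 / l ^ 2)) z := by
  have h1 : HasDerivAt (fun z : ℂ ↦ z - l) 1 z := (hasDerivAt_id z).sub_const l
  have h2 := h1.inv h
  have h3 := (h2.add_const (1 / l)).add ((hasDerivAt_id z).div_const (l ^ 2))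
  convert! h3 using 1
  · ext z; simp
  · ring

lemma termDeriv' (l : L.lattice) (z : ℂ) (h : z ∈ ((L.lattice : Set ℂ) \ {0})ᶜ) :
    HasDerivAt (fun z : ℂ ↦ if l.1 = 0 then 0 else (1 / (z - l) + 1 / l + z / l ^ 2))
      (-(if l.1 = 0 then 0 else (1 / (z - l) ^ 2 - 1 / l.1 ^ 2))) z := by
  split_ifs with hl
  · simpa using hasDerivAt_const z (0 : ℂ)
  · apply termDeriv
    intro e
    obtain rfl := sub_eq_zero.mp e
    apply h
    exact ⟨l.2, hl⟩

lemma zE_differentiableOn : DifferentiableOn ℂ (zE L) ((L.lattice : Set ℂ) \ {0})ᶜ := by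
  refine (hasSumLU L).hasSumLocallyUniformlyOn.differentiableOn
    (.of_forall fun s ↦ .fun_sum fun i hi ↦ ?_) L.isOpen_compl_lattice_sdiff
  exact fun z hz ↦ (termDeriv' L i z hz).differentiableAt.differentiableWithinAt

lemma zE_hasDerivAt (z : ℂ) (hz : z ∈ ((L.lattice : Set ℂ) \ {0})ᶜ) :
    HasDerivAt (zE L) (-(L.weierstrassPExcept 0 z)) z := by
  have hd : DifferentiableAt ℂ (zE L) z :=
    (zE_differentiableOn L).differentiableAt (L.isOpen_compl_lattice_sdiff.mem_nhds hz)
  have h1 := ((hasSumLU L).tendstoLocallyUniformlyOn (s := ((L.lattice : Set ℂ) \ {0})ᶜ)).deriv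
    (.of_forall fun s ↦ .fun_sum fun i hi ↦
      fun z hz ↦ (termDeriv' L i z hz).differentiableAt.differentiableWithinAt)
      L.isOpen_compl_lattice_sdiff
  have h2 := h1.tendsto_at hz
  have h3 := (L.hasSum_weierstrassPExcept 0 z).neg
  have h4 : deriv (zE L) z = -(L.weierstrassPExcept 0 z) := by
    refine tendsto_nhds_unique h2 ?_
    refine Filter.Tendsto.congr (fun s ↦ ?_) h3
    symm
    exact (HasDerivAt.fun_sum fun i _ ↦ termDeriv' L i z hz).deriv
  rw [← h4]
  exact hd.hasDerivAt

lemma wpE (z : ℂ) : L.weierstrassP z = L.weierstrassPExcept 0 z + 1 / z ^ 2 := by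
  have := L.weierstrassPExcept_add 0 z
  simpa using this.symm

lemma Z_hasDerivAt (z : ℂ) (hz : z ∉ L.lattice) : HasDerivAt (Z L) (-(L.weierstrassP z)) z := by
  have h0 : z ≠ 0 := by rintro rfl; exact hz (zero_mem _)
  have h1 := (hasDerivAt_inv h0).add (zE_hasDerivAt L z (fun h ↦ hz h.1))
  convert! h1 using 1
  · ext z; simp [Z]
  · rw [wpE]; ring

lemma zE_zero : zE L 0 = 0 := by
  unfold zE
  convert! tsum_zero with l
  split_ifs
  · rfl
  · simp

lemma Z_neg (z : ℂ) : Z L (-z) = - Z L z := by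
  unfold Z zE
  rw [← (Equiv.neg L.lattice).tsum_eq, neg_add, ← tsum_neg]
  congr 1
  · rw [div_neg]
  · congr with l
    simp only [Equiv.neg_apply, NegMemClass.coe_neg, neg_eq_zero]
    split_ifs
    · simp
    · rw [show -z - -(l : ℂ) = -(z - l) by ring, div_neg, div_neg]; ring

lemma Z_hasSum (z : ℂ) :
    HasSum (fun l : L.lattice ↦ 1 / (z - l) + 1 / l + z / l.1 ^ 2) (Z L z) := by
  have h1 := (hasSumLU L).hasSum (x := z)
  have h2 := (hasSum_ite_eq (0 : L.lattice) (1 / z)).add h1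
  change HasSum _ (1 / z + zE L z)
  convert! h2 using 2 with l
  by_cases hl : l = 0
  · simp [hl]
  · have hl' : l.1 ≠ 0 := by simpa using hl
    simp [hl, hl']

/-- The difference `ζ(z-w) - ζ(z)`is periodic. -/
lemma diff_periodic (w z : ℂ) (l : L.lattice) :
    Z L (z + l - w) - Z L (z + l) = Z L (z - w) - Z L z := by
  have key : ∀ z, HasSum (fun l : L.lattice ↦ 1 / (z - l - w) - 1 / (z - l) - w / (z - l.1) ^ 2)
      (Z L (z - w) - Z L z - w * L.weierstrassP z) := by
    intro z
    have := ((Z_hasSum L (z - w)).sub (Z_hasSum L z)).sub ((L.hasSum_weierstrassP z).mul_left w)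
    convert! this using 2 with l
    rw [show z - w - (l : ℂ) = z - l - w by ring]
    ring
  have h1 := key z
  have h2 := key (z + l)
  rw [L.weierstrassP_add_coe] at h2
  rw [← (Equiv.addRight l).hasSum_iff] at h2
  have h3 := h2.unique (a₂ := Z L (z - w) - Z L z - w * L.weierstrassP z) (by
    convert! h1 using 2 with i
    simp)
  linear_combination h3

open Classical in
/-- The defect of the identity, extended by zero. -/
def rel (w z : ℂ) : ℂ :=
  if z ∈ L.lattice ∨ z - w ∈ L.lattice then 0 else
    (Z L (z - w) - Z L z + Z L w) ^ 2 - L.weierstrassP z - L.weierstrassP w - L.weierstrassP (z - w)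

lemma rel_add (w z : ℂ) (l : L.lattice) : rel L w (z + l) = rel L w z := by
  have h1 : z + l ∈ L.lattice ↔ z ∈ L.lattice :=
    L.lattice.toAddSubgroup.add_mem_cancel_right (y := z) l.2
  have h2 : z + l - w ∈ L.lattice ↔ z - w ∈ L.lattice := by
    rw [show z + l - w = z - w + l by ring]
    exact L.lattice.toAddSubgroup.add_mem_cancel_right (y := z - w) l.2
  unfold rel
  rw [h1, h2, diff_periodic, L.weierstrassP_add_coe, show z + l - w = z - w + l by ring,
    L.weierstrassP_add_coe]

lemma rel_symm (w z : ℂ) : rel L w (w - z) = rel L w z := by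
  have h1 : w - z ∈ L.lattice ↔ z - w ∈ L.lattice := by
    rw [← neg_mem_iff, neg_sub]
  have h2 : w - z - w ∈ L.lattice ↔ z ∈ L.lattice := by
    rw [← neg_mem_iff]; simp
  have h3 : (w - z ∈ L.lattice ∨ w - z - w ∈ L.lattice) ↔
      (z ∈ L.lattice ∨ z - w ∈ L.lattice) := by
    rw [h1, h2, or_comm]
  unfold rel
  by_cases h4 : z ∈ L.lattice ∨ z - w ∈ L.lattice
  · rw [if_pos h4, if_pos (h3.mpr h4)]
  rw [if_neg h4, if_neg (fun h ↦ h4 (h3.mp h))]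
  rw [show w - z - w = -z by ring, show w - z = -(z - w) by ring, Z_neg, Z_neg,
    L.weierstrassP_neg, L.weierstrassP_neg]
  ring

lemma rel_differentiableAt (w z : ℂ) (h1 : z ∉ L.lattice) (h2 : z - w ∉ L.lattice) :
    DifferentiableAt ℂ (rel L w) z := by
  have hsub : HasDerivAt (fun z : ℂ ↦ z - w) 1 z := (hasDerivAt_id z).sub_const w
  have dP : ∀ z, z ∉ L.lattice → DifferentiableAt ℂ L.weierstrassP z := fun z hz ↦
    L.differentiableOn_weierstrassP.differentiableAt (L.isClosed_lattice.isOpen_compl.mem_nhds hz)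
  have d1 : DifferentiableAt ℂ (fun z ↦ Z L (z - w)) z :=
    DifferentiableAt.comp (g := Z L) z (Z_hasDerivAt L _ h2).differentiableAt hsub.differentiableAt
  have d2 : DifferentiableAt ℂ (fun z ↦ L.weierstrassP (z - w)) z :=
    DifferentiableAt.comp (g := L.weierstrassP) z (dP _ h2) hsub.differentiableAt
  have d3 := (Z_hasDerivAt L _ h1).differentiableAt
  have d4 := dP _ h1
  have d5 : DifferentiableAt ℂ (fun z ↦ (Z L (z - w) - Z L z + Z L w) ^ 2 - L.weierstrassP z -
      L.weierstrassP w - L.weierstrassP (z - w)) z := by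
    fun_prop
  refine d5.congr_of_eventuallyEq ?_
  have e1 := L.isClosed_lattice.isOpen_compl.mem_nhds h1
  have e2 := hsub.continuousAt.preimage_mem_nhds (L.isClosed_lattice.isOpen_compl.mem_nhds h2)
  filter_upwards [e1, e2] with x hx1 hx2
  unfold rel
  rw [if_neg]
  rintro (h | h)
  · exact hx1 h
  · exact hx2 h

lemma eventually_good (w : ℂ) (hw : w ∉ L.lattice) :
    ∀ᶠ z in 𝓝[≠] (0 : ℂ), z ∉ L.lattice ∧ z - w ∉ L.lattice := by
  have hc : ContinuousAt (fun z : ℂ ↦ z - w) 0 := by fun_prop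
  have h2 : (0 : ℂ) - w ∉ L.lattice := by simpa using hw
  have e1 := mem_nhdsWithin_of_mem_nhds (t := {0}ᶜ)
    (hc.preimage_mem_nhds (L.isClosed_lattice.isOpen_compl.mem_nhds h2))
  have e2 := mem_nhdsWithin_of_mem_nhds (t := {0}ᶜ) (L.compl_lattice_sdiff_singleton_mem_nhds 0)
  filter_upwards [e1, e2, self_mem_nhdsWithin] with z h1 h2 h3
  exact ⟨fun h ↦ h2 ⟨h, h3⟩, h1⟩

lemma rel_tendsto (w : ℂ) (hw : w ∉ L.lattice) : Tendsto (rel L w) (𝓝[≠] 0) (𝓝 0) := by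
  have hsub : HasDerivAt (fun z : ℂ ↦ z - w) 1 0 := (hasDerivAt_id 0).sub_const w
  have h2 : (0 : ℂ) - w ∉ L.lattice := by simpa using hw
  have hA : HasDerivAt (fun z ↦ Z L (z - w) - zE L z + Z L w) (-L.weierstrassP w) 0 := by
    have a1 := (Z_hasDerivAt L _ h2).comp (0 : ℂ) hsub
    have a2 := zE_hasDerivAt L 0 (by simp)
    convert! (a1.sub a2).add_const (Z L w) using 1
    simp
  have hA0 : Z L (0 - w) - zE L 0 + Z L w = 0 := by
    rw [zE_zero, zero_sub, Z_neg]; ring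
  have t1 := hA.tendsto_slope
  have t2 := hA.continuousAt.tendsto.mono_left (nhdsWithin_le_nhds (s := {0}ᶜ))
  simp only [hA0] at t2
  have t3 := (L.analyticAt_weierstrassPExcept 0).continuousAt.tendsto.mono_left
    (nhdsWithin_le_nhds (s := {0}ᶜ))
  rw [L.weierstrassPExcept_zero] at t3
  have t4 : Tendsto (fun z ↦ L.weierstrassP (z - w)) (𝓝[≠] 0) (𝓝 (L.weierstrassP w)) := by
    have c : ContinuousAt L.weierstrassP (0 - w) :=
      (L.differentiableOn_weierstrassP.differentiableAt
        (L.isClosed_lattice.isOpen_compl.mem_nhds h2)).continuousAt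
    have := (ContinuousAt.comp (f := fun z : ℂ ↦ z - w) c hsub.continuousAt).tendsto.mono_left
      (nhdsWithin_le_nhds (s := {0}ᶜ))
    simpa [Function.comp_def] using this
  have t5 := (((t1.const_mul (-2)).add (t2.pow 2)).sub t3).sub
    ((tendsto_const_nhds (x := L.weierstrassP w)).add t4)
  have t6 : Tendsto (rel L w) (𝓝[≠] 0) (𝓝 (-2 * -L.weierstrassP w + 0 ^ 2 - 0 -
      (L.weierstrassP w + L.weierstrassP w))) := by
    refine t5.congr' ?_
    filter_upwards [eventually_good L w hw, self_mem_nhdsWithin] with z hz hz0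
    have hz0 : z ≠ 0 := hz0
    unfold rel
    rw [if_neg (not_or.mpr hz), slope_def_field, hA0, wpE L z, Z]
    simp only [Z]
    field_simp
    ring
  convert! t6 using 2
  ring

lemma rel_differentiable (w : ℂ) (hw : w ∉ L.lattice) : Differentiable ℂ (rel L w) := by
  have h0 : DifferentiableAt ℂ (rel L w) 0 := by
    refine (Complex.analyticAt_of_differentiable_on_punctured_nhds_of_continuousAt ?_
      ?_).differentiableAt
    · filter_upwards [eventually_good L w hw] with z hz
      exact rel_differentiableAt L w z hz.1 hz.2
    · rw [continuousAt_iff_punctured_nhds]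
      convert! rel_tendsto L w hw using 2
      simp [rel]
  have h1 : ∀ z ∈ L.lattice, DifferentiableAt ℂ (rel L w) z := by
    intro z hz
    have : rel L w = rel L w ∘ (fun x ↦ x - z) := by
      ext x
      have := rel_add L w (x - z) ⟨z, hz⟩
      simpa using this
    rw [this]
    refine DifferentiableAt.comp z ?_ (by fun_prop)
    simpa using h0
  intro z
  by_cases hz : z ∈ L.lattice
  · exact h1 z hz
  by_cases hz2 : z - w ∈ L.lattice
  · have : rel L w = rel L w ∘ (fun x ↦ w - x) := by
      ext x
      exact (rel_symm L w x).symm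
    rw [this]
    refine DifferentiableAt.comp z (h1 _ ?_) (by fun_prop)
    rw [← neg_mem_iff, neg_sub]
    exact hz2
  · exact rel_differentiableAt L w z hz hz2

lemma rel_eq_zero (w : ℂ) (hw : w ∉ L.lattice) (z : ℂ) : rel L w z = 0 := by
  have hd := rel_differentiable L w hw
  refine (hd.apply_eq_apply_of_bounded (IsZLattice.isCompact_range_of_periodic L.lattice _
    hd.continuous fun z w hw ↦ ?_).isBounded z 0).trans ?_
  · exact rel_add L _ z ⟨w, hw⟩
  · simp [rel]

/-- The period pair `(1, τ)`. -/
def pp (τ : ℂ) (hτ : 0 < τ.im) : PeriodPair where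
  ω₁ := 1
  ω₂ := τ
  indep := by
    rw [LinearIndependent.pair_iff]
    intro s t h
    have h1 := congrArg Complex.im h
    have h2 := congrArg Complex.re h
    simp at h1 h2
    have : t = 0 := h1.resolve_right hτ.ne'
    subst this
    simpa using h2

lemma mem_pp (τ : ℂ) (hτ : 0 < τ.im) (z : ℂ) : z ∈ (pp τ hτ).lattice ↔ inLat τ z := by
  rw [PeriodPair.mem_lattice]
  simp [inLat, lat, pp, eq_comm]

lemma tsum_pp (τ : ℂ) (hτ : 0 < τ.im) (f : ℂ → ℂ) :
    ∑' p : {p : ℤ × ℤ // p ≠ 0}, f (lat τ p) =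
      ∑' l : (pp τ hτ).lattice, if l.1 = 0 then 0 else f l := by
  rw [← (pp τ hτ).latticeEquivProd.symm.toEquiv.tsum_eq]
  have := tsum_subtype {p : ℤ × ℤ | p ≠ 0} (fun p ↦ f (lat τ p))
  refine this.trans ?_
  congr with p
  have hl : (((pp τ hτ).latticeEquivProd.symm p : (pp τ hτ).lattice) : ℂ) = lat τ p := by
    rw [PeriodPair.latticeEquiv_symm_apply]; simp [lat, pp]
  have h0 : (((pp τ hτ).latticeEquivProd.symm p : (pp τ hτ).lattice) : ℂ) = 0 ↔ p = 0 := by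
    simp
  by_cases hp : p = 0
  · simp [hp]
  · have h0' := fun h ↦ hp (h0.mp h)
    rw [Set.indicator_of_mem (by exact hp)]
    change _ = if (((pp τ hτ).latticeEquivProd.symm p : (pp τ hτ).lattice) : ℂ) = 0 then 0
      else f (((pp τ hτ).latticeEquivProd.symm p : (pp τ hτ).lattice) : ℂ)
    rw [if_neg h0', hl]

lemma wzeta_eq (τ : ℂ) (hτ : 0 < τ.im) (z : ℂ) : wzeta τ z = Z (pp τ hτ) z := by
  unfold wzeta Z zE
  rw [tsum_pp τ hτ (fun l ↦ 1 / (z - l) + 1 / l + z / l ^ 2)]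

lemma wp_eq (τ : ℂ) (hτ : 0 < τ.im) (z : ℂ) : wp τ z = (pp τ hτ).weierstrassP z := by
  rw [wpE, add_comm]
  unfold wp PeriodPair.weierstrassPExcept
  rw [tsum_pp τ hτ (fun l ↦ 1 / (z - l) ^ 2 - 1 / l ^ 2)]

end WZ

/-- **A classical elliptic function identity.**
For `z, w, z−w ∉ Λ`, `(ζ(z−w) − ζ(z) + ζ(w))² = ℘(z) + ℘(w) + ℘(z−w)`. -/
theorem wzeta_sq_eq_wp_sum (τ : ℂ) (hτ : 0 < τ.im) (z w : ℂ)
    (hz : ¬ inLat τ z) (hw : ¬ inLat τ w) (hzw : ¬ inLat τ (z - w)) :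
    (wzeta τ (z - w) - wzeta τ z + wzeta τ w) ^ 2 =
      wp τ z + wp τ w + wp τ (z - w) := by
  have h := WZ.rel_eq_zero (WZ.pp τ hτ) w (by rwa [WZ.mem_pp]) z
  unfold WZ.rel at h
  rw [if_neg (by rw [WZ.mem_pp, WZ.mem_pp]; exact not_or.mpr ⟨hz, hzw⟩)] at h
  simp only [WZ.wzeta_eq τ hτ, WZ.wp_eq τ hτ]
  linear_combination h

end
end

section
/- For every z ∈ ℂ∖Λ one has ℘′(z)² = 4·℘(z)³ − 60·G₄(τ)·℘(z) − 140·G₆(τ), where ℘′ denotes the complex derivative of ℘. (This is the Weierstrass differential equation realizing ℂ/Λ as the plane cubic V²Z = 4U³ − 60G₄(τ)UZ² − 140G₆(τ)Z³ via x ↦ [℘(x) : ℘′(x) : 1].) -/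
noncomputable section

/-- The Eisenstein series `G_m(τ) = Σ_{λ ∈ Λ∖{0}} λ^{−m}` (absolutely convergent for
`m ≥ 3`). -/
def Gee (τ : ℂ) (m : ℕ) : ℂ := ∑' p : {p : ℤ × ℤ // p ≠ 0}, 1 / (lat τ ↑p) ^ m

/-- The period pair `(1, τ)`. -/
def auxPair (τ : ℂ) (hτ : 0 < τ.im) : PeriodPair where
  ω₁ := 1
  ω₂ := τ
  indep := by
    rw [LinearIndependent.pair_iff]
    intro s t h
    have h2 := congrArg Complex.im h
    have h1 := congrArg Complex.re h
    simp at h1 h2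
    have ht : t = 0 := by
      rcases h2 with h2 | h2
      · exact h2
      · exact absurd h2 hτ.ne'
    subst ht
    simpa using h1

lemma aux_symm (τ : ℂ) (hτ : 0 < τ.im) (p : ℤ × ℤ) :
    (((auxPair τ hτ).latticeEquivProd.symm p : (auxPair τ hτ).lattice) : ℂ) = lat τ p := by
  rw [PeriodPair.latticeEquiv_symm_apply]
  simp [auxPair, lat]

lemma aux_lat_eq_zero (τ : ℂ) (hτ : 0 < τ.im) (p : ℤ × ℤ) : lat τ p = 0 ↔ p = 0 := by
  rw [← aux_symm τ hτ]
  simp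

/-- Sums over nonzero index pairs are sums over the lattice. -/
lemma aux_tsum (τ : ℂ) (hτ : 0 < τ.im) (f : ℂ → ℂ) :
    ∑' p : {p : ℤ × ℤ // p ≠ 0}, f (lat τ ↑p) =
      ∑' l : (auxPair τ hτ).lattice, if (l : ℂ) = 0 then 0 else f l := by
  rw [← (auxPair τ hτ).latticeEquivProd.symm.toEquiv.tsum_eq]
  have h := tsum_subtype {p : ℤ × ℤ | p ≠ 0} (fun p => f (lat τ p))
  refine h.trans (tsum_congr fun p => ?_)
  have e : (((auxPair τ hτ).latticeEquivProd.symm.toEquiv p : (auxPair τ hτ).lattice) : ℂ)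
      = lat τ p := aux_symm τ hτ p
  rw [e]
  by_cases hp : p = 0
  · rw [if_pos ((aux_lat_eq_zero τ hτ p).2 hp)]
    simp [hp]
  · rw [if_neg (fun h => hp ((aux_lat_eq_zero τ hτ p).1 h))]
    simp [hp]

lemma aux_Gee (τ : ℂ) (hτ : 0 < τ.im) (m : ℕ) (hm : m ≠ 0) :
    Gee τ m = (auxPair τ hτ).G m := by
  unfold Gee PeriodPair.G
  rw [aux_tsum τ hτ (fun l => 1 / l ^ m)]
  refine tsum_congr fun l => ?_
  split_ifs with h
  · simp [h, hm]
  · simp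

lemma aux_wp (τ : ℂ) (hτ : 0 < τ.im) : wp τ = (auxPair τ hτ).weierstrassP := by
  funext z
  have h := (auxPair τ hτ).weierstrassPExcept_add 0 z
  rw [← h]
  unfold wp PeriodPair.weierstrassPExcept
  rw [aux_tsum τ hτ (fun l => 1 / (z - l) ^ 2 - 1 / l ^ 2)]
  simp [add_comm]

/-- **The Weierstrass differential equation.**
For every `z ∉ Λ`, `℘′(z)² = 4·℘(z)³ − 60·G₄(τ)·℘(z) − 140·G₆(τ)`, realizing `ℂ/Λ` as
the plane cubic `V²Z = 4U³ − 60G₄(τ)UZ² − 140G₆(τ)Z³` via `x ↦ [℘(x) : ℘′(x) : 1]`. -/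
theorem wp_differential_equation (τ : ℂ) (hτ : 0 < τ.im) (z : ℂ) (hz : ¬ inLat τ z) :
    (deriv (wp τ) z) ^ 2 =
      4 * (wp τ z) ^ 3 - 60 * Gee τ 4 * wp τ z - 140 * Gee τ 6 := by
  have hz' : z ∉ (auxPair τ hτ).lattice := by
    intro h
    obtain ⟨m, n, e⟩ := PeriodPair.mem_lattice.1 h
    exact hz ⟨(m, n), by rw [← e]; simp [lat, auxPair]⟩
  have h := (auxPair τ hτ).derivWeierstrassP_sq z hz'
  rw [aux_wp τ hτ, PeriodPair.deriv_weierstrassP, aux_Gee τ hτ 4 (by norm_num),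
    aux_Gee τ hτ 6 (by norm_num), h, PeriodPair.g₂, PeriodPair.g₃]

end
end

section
/- For every integer k ≥ 2, the Eisenstein series admits the q-expansion Σ_{λ ∈ Λ∖{0}} λ^{−2k} = (−1)^{k+1}·((2π)^{2k}·B_{2k}/(2k)!)·(1 − (4k/B_{2k})·Σ_{n≥1} n^{2k−1}·qⁿ/(1−qⁿ)), where B_{2k} denotes the 2k-th Bernoulli number; the series on the right converges absolutely since |q| < 1. -/
noncomputable section

/-- **q-expansion of Eisenstein series.**
For `k ≥ 2`, with `q = exp(2πiτ)` (so `|q| < 1`), the series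
`Σ_{n≥1} n^{2k−1} qⁿ/(1−qⁿ)` converges absolutely and
`Σ_{λ ∈ Λ∖{0}} λ^{−2k}
  = (−1)^{k+1}·((2π)^{2k} B_{2k}/(2k)!)·(1 − (4k/B_{2k})·Σ_{n≥1} n^{2k−1} qⁿ/(1−qⁿ))`,
where `B_{2k}` is the `2k`-th Bernoulli number. -/
theorem eisenstein_q_expansion (τ : ℂ) (hτ : 0 < τ.im) (k : ℕ) (hk : 2 ≤ k) :
    (Summable fun n : ℕ =>
      (n : ℂ) ^ (2 * k - 1) * Complex.exp (2 * (Real.pi : ℂ) * Complex.I * τ) ^ n /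
        (1 - Complex.exp (2 * (Real.pi : ℂ) * Complex.I * τ) ^ n)) ∧
    Gee τ (2 * k) =
      (-1 : ℂ) ^ (k + 1) *
        ((2 * (Real.pi : ℂ)) ^ (2 * k) * (bernoulli (2 * k) : ℂ) /
          (Nat.factorial (2 * k) : ℂ)) *
        (1 - (4 * (k : ℂ) / (bernoulli (2 * k) : ℂ)) *
          ∑' n : ℕ,
            (n : ℂ) ^ (2 * k - 1) * Complex.exp (2 * (Real.pi : ℂ) * Complex.I * τ) ^ n /
              (1 - Complex.exp (2 * (Real.pi : ℂ) * Complex.I * τ) ^ n)) := by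
  set q := Complex.exp (2 * (Real.pi : ℂ) * Complex.I * τ) with hqdef
  let z : UpperHalfPlane := ⟨τ, hτ⟩
  have hz : (z : ℂ) = τ := rfl
  have hq : ‖q‖ < 1 := UpperHalfPlane.norm_exp_two_pi_I_lt_one z
  have hsum : Summable fun n : ℕ => (n : ℂ) ^ (2 * k - 1) * q ^ n / (1 - q ^ n) :=
    summable_norm_pow_mul_geometric_div_one_sub (2 * k - 1) hq
  refine ⟨hsum, ?_⟩
  have key := tsum_eisSummand_eq_tsum_sigma_mul_cexp_pow
    (k := 2 * k) (by omega) (by simp) z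
  have hG : Gee τ (2 * k) = ∑' v, EisensteinSeries.eisSummand (2 * k : ℕ) v z := by
    have e : ∑' v, EisensteinSeries.eisSummand (2 * k : ℕ) v z =
        ∑' p : ℤ × ℤ, 1 / (lat τ p) ^ (2 * k) := by
      rw [← ((finTwoArrowEquiv ℤ).trans (Equiv.prodComm ℤ ℤ)).tsum_eq]
      refine tsum_congr fun v => ?_
      simp only [EisensteinSeries.eisSummand, lat, hz, zpow_neg, zpow_natCast, one_div,
        Equiv.trans_apply, finTwoArrowEquiv_apply, Equiv.prodComm_apply, Prod.fst_swap,
        Prod.snd_swap]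
      rw [add_comm]
      rfl
    rw [e, Gee]
    refine tsum_subtype_eq_of_support_subset (f := fun p : ℤ × ℤ => 1 / (lat τ p) ^ (2 * k))
      (s := {p | p ≠ 0}) ?_
    intro p hp h0
    apply hp
    subst h0
    have : 2 * k ≠ 0 := by omega
    simp [lat, show k ≠ 0 by omega]
  have hz2 := riemannZeta_two_mul_nat (k := k) (by omega)
  have hzne : riemannZeta (2 * (k : ℂ)) ≠ 0 := by
    apply riemannZeta_ne_zero_of_one_le_re
    simp
    have : (2 : ℝ) ≤ k := by exact_mod_cast hk
    linarith
  have hB : (bernoulli (2 * k) : ℂ) ≠ 0 := by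
    intro h
    rw [hz2, h] at hzne
    simp at hzne
  rw [hG, key, hz, ← hqdef, ← tsum_pow_div_one_sub_eq_tsum_sigma hq]
  rw [← tsum_zero_pnat_eq_tsum_nat hsum]
  push_cast
  rw [hz2]
  set S := ∑' n : ℕ+, (n : ℂ) ^ (2 * k - 1) * q ^ (n : ℕ) / (1 - q ^ (n : ℕ))
  obtain ⟨m, rfl⟩ : ∃ m, k = m + 1 := ⟨k - 1, by omega⟩
  have hf : (((2 * (m + 1)).factorial : ℕ) : ℂ) =
      2 * ((m : ℂ) + 1) * ((2 * (m + 1) - 1).factorial : ℕ) := by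
    rw [show 2 * (m + 1) - 1 = 2 * m + 1 by omega, show 2 * (m + 1) = (2 * m + 1) + 1 by ring,
      Nat.factorial_succ]
    push_cast; ring
  have hf0 : (((2 * (m + 1) - 1).factorial : ℕ) : ℂ) ≠ 0 := by
    exact_mod_cast Nat.factorial_ne_zero _
  have hm : (m : ℂ) + 1 ≠ 0 := by exact_mod_cast Nat.succ_ne_zero m
  have h0 : (0 : ℂ) ^ (2 * (m + 1) - 1) = 0 := by simp [show 2 * (m + 1) - 1 ≠ 0 by omega]
  have hI : (-2 * (Real.pi : ℂ) * Complex.I) ^ (2 * (m + 1)) =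
      (-1) ^ (m + 1) * (2 * (Real.pi : ℂ)) ^ (2 * (m + 1)) := by
    rw [pow_mul, pow_mul, ← mul_pow]
    congr 1
    ring_nf
    simp
  have h2 : (2 * (Real.pi : ℂ)) ^ (2 * (m + 1)) =
      2 * (2 ^ (2 * (m + 1) - 1) * (Real.pi : ℂ) ^ (2 * (m + 1))) := by
    rw [show 2 * (m + 1) - 1 = 2 * m + 1 by omega]; ring
  rw [hI, h2, hf]
  simp only [CharP.cast_eq_zero, h0, zero_mul, zero_div, zero_add, Nat.cast_add, Nat.cast_one]
  field_simp
  ring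

end
end
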